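/- Let N ≥ 1, (λ, β, α, η) ∈ (0, ∞)⁴, let H : ℝ^N → ℝ^N be a linear map (e.g., convolution with a fixed kernel h) with operator norm ‖H‖, let y ∈ ℝ^N, and define f(x) = (1/2)·‖Hx − y‖² + φ(x), where φ(x) = λ·log((ℓ_{1,α}(x) + β)/ℓ_{2,η}(x)), ℓ_{1,α}(x) = Σ_{n=1}^N (√(x_n² + α²) − α), and ℓ_{2,η}(x) = √(‖x‖² + η²). Then for every x ∈ ℝ^N, the matrix A₁(x) = (‖H‖² + 9λ/(8η²))·I_N + (λ/(ℓ_{1,α}(x)+β))·Diag((x_n² + α²)^{−1/2}) satisfies the majoration condition for f at x: for all x' ∈ ℝ^N, f(x') ≤ f(x) + ⟨x' − x, ∇f(x)⟩ + (1/2)·(x'−x)ᵀA₁(x)(x'−x). -/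

import Mathlib

open RealInnerProductSpace

lemma sot_sqrt_majoration (a b α : ℝ) (hα : 0 < α) :
    Real.sqrt (b ^ 2 + α ^ 2) ≤ Real.sqrt (a ^ 2 + α ^ 2)
      + a * (b - a) / Real.sqrt (a ^ 2 + α ^ 2)
      + (1 / 2) * ((b - a) ^ 2 / Real.sqrt (a ^ 2 + α ^ 2)) := by
  have hs : 0 < Real.sqrt (a ^ 2 + α ^ 2) := Real.sqrt_pos.2 (by positivity)
  have h1 : Real.sqrt (a ^ 2 + α ^ 2) ^ 2 = a ^ 2 + α ^ 2 := Real.sq_sqrt (by positivity)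
  have h2 : Real.sqrt (b ^ 2 + α ^ 2) ^ 2 = b ^ 2 + α ^ 2 := Real.sq_sqrt (by positivity)
  set S := Real.sqrt (a ^ 2 + α ^ 2)
  set T := Real.sqrt (b ^ 2 + α ^ 2)
  have : S + a * (b - a) / S + (1 / 2) * ((b - a) ^ 2 / S) - T = (S - T) ^ 2 / (2 * S) := by
    field_simp
    nlinarith
  have h3 : 0 ≤ (S - T) ^ 2 / (2 * S) := by positivity
  linarith

lemma sot_log_majoration {V : Type*} [NormedAddCommGroup V] [InnerProductSpace ℝ V]
    (x x' : V) (η : ℝ) (hη : 0 < η) :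
    Real.log (‖x‖ ^ 2 + η ^ 2) - Real.log (‖x'‖ ^ 2 + η ^ 2)
      ≤ -(2 * ⟪x, x' - x⟫) / (‖x‖ ^ 2 + η ^ 2) + ‖x' - x‖ ^ 2 / η ^ 2 := by
  have hx' : ‖x'‖ ^ 2 = ‖x‖ ^ 2 + 2 * ⟪x, x' - x⟫ + ‖x' - x‖ ^ 2 := by
    have := norm_add_sq_real x (x' - x)
    simpa using this
  have hc1 : ⟪x, x' - x⟫ ^ 2 ≤ ‖x‖ ^ 2 * ‖x' - x‖ ^ 2 := by
    rw [← mul_pow, ← sq_abs]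
    exact pow_le_pow_left₀ (abs_nonneg _) (abs_real_inner_le_norm _ _) 2
  have hc2 : (‖x‖ ^ 2 + ⟪x, x' - x⟫) ^ 2 ≤ ‖x‖ ^ 2 * ‖x'‖ ^ 2 := by
    rw [hx']
    nlinarith
  have hX : 0 ≤ ‖x‖ ^ 2 := by positivity
  have hX' : 0 ≤ ‖x'‖ ^ 2 := by positivity
  have hD : 0 ≤ ‖x' - x‖ ^ 2 := by positivity
  have hE : 0 < η ^ 2 := by positivity
  generalize ‖x‖ ^ 2 = X at *
  generalize ‖x'‖ ^ 2 = Y at *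
  generalize ‖x' - x‖ ^ 2 = D at *
  generalize ⟪x, x' - x⟫ = p at *
  generalize η ^ 2 = E at *
  have hs : 0 < X + E := by linarith
  have hs' : 0 < Y + E := by linarith
  rw [← Real.log_div hs.ne' hs'.ne']
  refine (Real.log_le_sub_one_of_pos (div_pos hs hs')).trans ?_
  have hprod : E * (X + Y + 2 * (X + p)) ≤ (X + E) * (Y + E) := by
    nlinarith [sq_nonneg (X + p - E)]
  have key : E * (4 * p ^ 2 + 2 * p * D - D * (X + E)) ≤ D * ((X + E) * (Y + E)) := by
    have h1 := mul_le_mul_of_nonneg_left hprod hD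
    have h2 : 4 * p ^ 2 + 2 * p * D - D * (X + E) ≤ D * (X + Y + 2 * (X + p)) := by
      nlinarith [mul_nonneg hD hs'.le]
    nlinarith [mul_le_mul_of_nonneg_left h2 hE.le]
  have : -(2 * p) / (X + E) + D / E - ((X + E) / (Y + E) - 1)
      = (D * ((X + E) * (Y + E)) - E * (4 * p ^ 2 + 2 * p * D - D * (X + E)))
        / (E * ((X + E) * (Y + E))) := by
    field_simp
    subst hx'
    ring
  have h3 : 0 ≤ (D * ((X + E) * (Y + E)) - E * (4 * p ^ 2 + 2 * p * D - D * (X + E)))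
        / (E * ((X + E) * (Y + E))) := div_nonneg (by linarith) (by positivity)
  linarith

/-- The matrix
`A₁(x) = (‖H‖² + 9λ/(8η²))·I_N + (λ/(ℓ_{1,α}(x)+β))·Diag((xₙ² + α²)^(−1/2))`
satisfies the majoration condition for `f(x) = (1/2)‖Hx − y‖² + φ(x)` at every `x`,
where `φ(x) = λ·log((ℓ_{1,α}(x) + β)/ℓ_{2,η}(x))`. -/
theorem sot_smooth_part_majoration (N : ℕ) (hN : 1 ≤ N) (lam β α η : ℝ)
    (hlam : 0 < lam) (hβ : 0 < β) (hα : 0 < α) (hη : 0 < η)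
    (H : EuclideanSpace ℝ (Fin N) →L[ℝ] EuclideanSpace ℝ (Fin N))
    (y : EuclideanSpace ℝ (Fin N))
    (ℓ : EuclideanSpace ℝ (Fin N) → ℝ)
    (hℓ : ∀ x, ℓ x = ∑ n, (Real.sqrt ((x n) ^ 2 + α ^ 2) - α))
    (φ : EuclideanSpace ℝ (Fin N) → ℝ)
    (hφ : ∀ x, φ x = lam * Real.log ((ℓ x + β) / Real.sqrt (‖x‖ ^ 2 + η ^ 2)))
    (f : EuclideanSpace ℝ (Fin N) → ℝ)
    (hf : ∀ x, f x = (1 / 2) * ‖H x - y‖ ^ 2 + φ x)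
    (x x' : EuclideanSpace ℝ (Fin N)) :
    f x' ≤ f x + ⟪x' - x, gradient f x⟫
        + (1 / 2) * ((‖H‖ ^ 2 + 9 * lam / (8 * η ^ 2)) * ‖x' - x‖ ^ 2
            + (lam / (ℓ x + β))
              * ∑ n, (x' n - x n) ^ 2 / Real.sqrt ((x n) ^ 2 + α ^ 2)) := by
  have hℓ0 : ∀ z, 0 ≤ ℓ z := by
    intro z
    rw [hℓ]
    refine Finset.sum_nonneg fun n _ => sub_nonneg.2 (Real.le_sqrt_of_sq_le ?_)
    nlinarith [sq_nonneg (z n)]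
  have hL : ∀ z, 0 < ℓ z + β := fun z => by linarith [hℓ0 z]
  have hf' : f = fun z => (1 / 2) * ‖H z - y‖ ^ 2
      + lam * (Real.log (ℓ z + β) - (1 / 2) * Real.log (‖z‖ ^ 2 + η ^ 2)) := by
    funext z
    have h2 : 0 < ‖z‖ ^ 2 + η ^ 2 := by positivity
    rw [hf, hφ, Real.log_div (hL z).ne' (Real.sqrt_pos.2 h2).ne', Real.log_sqrt h2.le]
    ring
  -- derivatives
  have hdℓ : HasFDerivAt ℓ (∑ n, (x n / Real.sqrt ((x n) ^ 2 + α ^ 2)) •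
      (EuclideanSpace.proj n : EuclideanSpace ℝ (Fin N) →L[ℝ] ℝ)) x := by
    have : ℓ = fun z => ∑ n, (Real.sqrt ((z n) ^ 2 + α ^ 2) - α) := funext hℓ
    rw [this]
    refine HasFDerivAt.fun_sum fun n _ => ?_
    have h1 : HasFDerivAt (fun z : EuclideanSpace ℝ (Fin N) => z n)
      (EuclideanSpace.proj n : EuclideanSpace ℝ (Fin N) →L[ℝ] ℝ) x :=
      (EuclideanSpace.proj n : EuclideanSpace ℝ (Fin N) →L[ℝ] ℝ).hasFDerivAt
    have hp : (x n) ^ 2 + α ^ 2 ≠ 0 := by positivity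
    have h2 : HasDerivAt (fun t : ℝ => Real.sqrt (t ^ 2 + α ^ 2) - α)
        (x n / Real.sqrt ((x n) ^ 2 + α ^ 2)) (x n) := by
      have := ((((hasDerivAt_id (x n)).pow 2).add_const (α ^ 2)).sqrt hp).sub_const α
      refine this.congr_deriv ?_
      simp
      field_simp
    exact h2.comp_hasFDerivAt x h1
  have hd1 := ((H.hasFDerivAt (x := x)).sub_const y).norm_sq
  have hd2 := (hasFDerivAt_id (𝕜 := ℝ) x).norm_sq
  have hs : 0 < ‖x‖ ^ 2 + η ^ 2 := by positivity
  have hd3 := (hd2.add_const (η ^ 2)).log hs.ne'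
  have hd4 := (hdℓ.add_const β).log (hL x).ne'
  have hd := (hd1.const_mul (1 / 2)).add ((hd4.sub (hd3.const_mul (1 / 2))).const_mul lam)
  have hfd := hd.congr_of_eventuallyEq (f₁ := f)
    (Filter.Eventually.of_forall fun z => congrFun hf' z)
  have hgrad : ⟪x' - x, gradient f x⟫ = ⟪H x - y, H (x' - x)⟫
      + lam * ((∑ n, x n * (x' n - x n) / Real.sqrt ((x n) ^ 2 + α ^ 2)) / (ℓ x + β)
        - ⟪x, x' - x⟫ / (‖x‖ ^ 2 + η ^ 2)) := by
    rw [real_inner_comm, gradient, InnerProductSpace.toDual_symm_apply, hfd.fderiv]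
    have hev : (∑ n, (x n / Real.sqrt ((x n) ^ 2 + α ^ 2)) •
      (EuclideanSpace.proj n : EuclideanSpace ℝ (Fin N) →L[ℝ] ℝ)) (x' - x)
        = ∑ n, x n * (x' n - x n) / Real.sqrt ((x n) ^ 2 + α ^ 2) := by
      simp [div_mul_eq_mul_div]
    rw [← hev]
    generalize (∑ n, (x n / Real.sqrt ((x n) ^ 2 + α ^ 2)) •
      (EuclideanSpace.proj n : EuclideanSpace ℝ (Fin N) →L[ℝ] ℝ)) = L
    simp only [add_apply, sub_apply, smul_apply, ContinuousLinearMap.comp_apply,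
      innerSL_apply_apply, ContinuousLinearMap.id_apply, id, smul_eq_mul, nsmul_eq_mul]
    push_cast
    ring
  have hquad : ‖H x' - y‖ ^ 2 ≤ ‖H x - y‖ ^ 2 + 2 * ⟪H x - y, H (x' - x)⟫
      + ‖H‖ ^ 2 * ‖x' - x‖ ^ 2 := by
    have h1 : H x' - y = (H x - y) + H (x' - x) := by
      rw [map_sub]
      abel
    rw [h1, norm_add_sq_real]
    have h2 := pow_le_pow_left₀ (norm_nonneg _) (H.le_opNorm (x' - x)) 2
    rw [mul_pow] at h2
    linarith
  have hsum : ℓ x' ≤ ℓ x + (∑ n, x n * (x' n - x n) / Real.sqrt ((x n) ^ 2 + α ^ 2))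
      + (1 / 2) * ∑ n, (x' n - x n) ^ 2 / Real.sqrt ((x n) ^ 2 + α ^ 2) := by
    rw [hℓ, hℓ, Finset.mul_sum, ← Finset.sum_add_distrib, ← Finset.sum_add_distrib]
    refine Finset.sum_le_sum fun n _ => ?_
    linarith [sot_sqrt_majoration (x n) (x' n) α hα]
  have hlog1 : Real.log (ℓ x' + β) - Real.log (ℓ x + β) ≤
      (∑ n, x n * (x' n - x n) / Real.sqrt ((x n) ^ 2 + α ^ 2)) / (ℓ x + β)
      + (1 / 2) * ((∑ n, (x' n - x n) ^ 2 / Real.sqrt ((x n) ^ 2 + α ^ 2)) / (ℓ x + β)) := by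
    rw [← Real.log_div (hL x').ne' (hL x).ne']
    refine (Real.log_le_sub_one_of_pos (div_pos (hL x') (hL x))).trans ?_
    rw [div_sub_one (hL x).ne', ← mul_div_assoc, ← add_div]
    exact div_le_div_of_nonneg_right (by linarith) (hL x).le
  have hlog2 := sot_log_majoration x x' η hη
  have hD : 0 ≤ ‖x' - x‖ ^ 2 / η ^ 2 := by positivity
  rw [hgrad]
  simp only [hf']
  have e1 : 9 * lam / (8 * η ^ 2) * ‖x' - x‖ ^ 2 = lam * (9 / 8 * (‖x' - x‖ ^ 2 / η ^ 2)) := by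
    field_simp
  have e2 : -(2 * ⟪x, x' - x⟫) / (‖x‖ ^ 2 + η ^ 2)
      = -2 * (⟪x, x' - x⟫ / (‖x‖ ^ 2 + η ^ 2)) := by ring
  rw [add_mul, e1, div_mul_eq_mul_div lam, mul_div_assoc lam]
  rw [e2] at hlog2
  have hfin := mul_le_mul_of_nonneg_left
    (add_le_add hlog1 (mul_le_mul_of_nonneg_left hlog2 (by norm_num : (0 : ℝ) ≤ 1 / 2))) hlam.le
  nlinarith [mul_nonneg hlam.le hD]
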